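/- If nonnegative vectors q^(0), …, q^(N), r^(0), …, r^(N) ∈ ℝ^V satisfy the GFPush invariant for s and the termination condition r^(m)_v ≤ d_v · r_max holds for every node v and every 0 ≤ m ≤ N−1 (with r_max > 0), then for every 0 ≤ n ≤ N: ‖P^n_s − q^(n)‖₁ ≤ n · (2|E| + |V|) · r_max. (The per-level approximation bound derived in the proof of Theorem 1.) -/

import Mathlib

open Finset Matrix

/-- The row-normalized adjacency matrix `P = D̃⁻¹ Ã` of the self-loop-augmented graph `G̃`. -/
noncomputable def rowNormAdj (V : Type) [Fintype V] [DecidableEq V]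
    (G : SimpleGraph V) [DecidableRel G.Adj] : Matrix V V ℝ :=
  Matrix.of fun v u => if u = v ∨ G.Adj v u then 1 / ((G.degree v : ℝ) + 1) else 0

theorem rowNormAdj_mem_rowStochastic {V : Type} [Fintype V] [DecidableEq V]
    (G : SimpleGraph V) [DecidableRel G.Adj] : rowNormAdj V G ∈ rowStochastic ℝ V := by
  rw [mem_rowStochastic_iff_sum]
  refine ⟨fun v u => ?_, fun v => ?_⟩
  · simp only [rowNormAdj, of_apply]
    split_ifs <;> positivity
  · have hcard : #{u | u = v ∨ G.Adj v u} = G.degree v + 1 := by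
      have : ({u | u = v ∨ G.Adj v u} : Finset V) = insert v (G.neighborFinset v) := by
        ext u; simp
      rw [this, card_insert_of_notMem (by simp), G.card_neighborFinset_eq_degree]
    have hpos : (G.degree v : ℝ) + 1 ≠ 0 := by positivity
    simp only [rowNormAdj, of_apply, ← sum_filter, sum_const, hcard, nsmul_eq_mul]
    push_cast
    field_simp

theorem Matrix.sum_transpose_mulVec_of_mem_rowStochastic {V : Type*} [Fintype V] [DecidableEq V]
    {M : Matrix V V ℝ} (hM : M ∈ rowStochastic ℝ V) (x : V → ℝ) :
    ∑ u, (Mᵀ *ᵥ x) u = ∑ v, x v := by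
  simp only [mulVec, dotProduct, transpose_apply]
  rw [sum_comm]
  simp only [← sum_mul, sum_row_of_mem_rowStochastic hM, one_mul]

theorem SimpleGraph.sum_degree_add_one {V : Type*} [Fintype V] [DecidableEq V]
    (G : SimpleGraph V) [DecidableRel G.Adj] :
    ∑ v, ((G.degree v : ℝ) + 1) = 2 * (#G.edgeFinset : ℝ) + Fintype.card V := by
  have h : ∑ v, (G.degree v : ℝ) = 2 * (#G.edgeFinset : ℝ) := by
    exact_mod_cast G.sum_degrees_eq_twice_card_edges
  simp [sum_add_distrib, h]

/-- The per-level approximation bound derived in the proof of Theorem 1 of "GRAND+": if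
nonnegative vectors `q⁽⁰⁾, …, q⁽ᴺ⁾, r⁽⁰⁾, …, r⁽ᴺ⁾` satisfy the GFPush invariant for `s` and
the termination condition `r⁽ᵐ⁾_v ≤ d_v · r_max` holds for every `v` and `0 ≤ m ≤ N − 1`
(with `r_max > 0`), then for every `0 ≤ n ≤ N`,
`‖P^n_s − q⁽ⁿ⁾‖₁ ≤ n · (2|E| + |V|) · r_max`. -/
theorem gfpush_per_level_error_bound
    {V : Type} [Fintype V] [DecidableEq V]
    (G : SimpleGraph V) [DecidableRel G.Adj]
    (s : V) (N : ℕ) (hN : 1 ≤ N)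
    (q r : ℕ → V → ℝ)
    (hq : ∀ n ≤ N, ∀ u, 0 ≤ q n u)
    (hr : ∀ n ≤ N, ∀ u, 0 ≤ r n u)
    (hinv : ∀ n ≤ N, ∀ u, (rowNormAdj V G ^ n) s u
      = q n u + ∑ i ∈ Finset.Icc 1 n, ((rowNormAdj V G ^ i)ᵀ.mulVec (r (n - i))) u)
    (r_max : ℝ) (hrmax : 0 < r_max)
    (hterm : ∀ v : V, ∀ m < N, r m v ≤ ((G.degree v : ℝ) + 1) * r_max) :
    ∀ n ≤ N, ∑ u, |(rowNormAdj V G ^ n) s u - q n u|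
      ≤ (n : ℝ) * (2 * (G.edgeFinset.card : ℝ) + (Fintype.card V : ℝ)) * r_max := by
  intro n hn
  have hstoch (i : ℕ) : rowNormAdj V G ^ i ∈ rowStochastic ℝ V :=
    pow_mem (rowNormAdj_mem_rowStochastic G) i
  have hnonneg (u : V) :
      0 ≤ ∑ i ∈ Icc 1 n, ((rowNormAdj V G ^ i)ᵀ *ᵥ r (n - i)) u :=
    sum_nonneg fun i _ => sum_nonneg fun v _ =>
      mul_nonneg (nonneg_of_mem_rowStochastic (hstoch i)) (hr _ (by omega) v)
  calc ∑ u, |(rowNormAdj V G ^ n) s u - q n u|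
      = ∑ u, ∑ i ∈ Icc 1 n, ((rowNormAdj V G ^ i)ᵀ *ᵥ r (n - i)) u := by
        refine sum_congr rfl fun u _ => ?_
        rw [hinv n hn u, add_sub_cancel_left, abs_of_nonneg (hnonneg u)]
    _ = ∑ i ∈ Icc 1 n, ∑ v, r (n - i) v := by
        rw [sum_comm]
        exact sum_congr rfl fun i _ => sum_transpose_mulVec_of_mem_rowStochastic (hstoch i) _
    _ ≤ ∑ i ∈ Icc 1 n, ∑ v, ((G.degree v : ℝ) + 1) * r_max := by
        refine sum_le_sum fun i hi => sum_le_sum fun v _ => hterm v _ ?_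
        have := mem_Icc.mp hi
        omega
    _ = n * (2 * (#G.edgeFinset : ℝ) + Fintype.card V) * r_max := by
        rw [← sum_mul, G.sum_degree_add_one]
        simp [mul_assoc]
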